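/- Let p : ℕ → ℝ be a probability mass function on the nonnegative integers (p(m) ≥ 0 for all m, Σ_{m=0}^∞ p(m) = 1) with finite mean μ = Σ_{m=0}^∞ m·p(m), and let n ≥ 2 be an integer. Define q₀ = Σ_{m=0}^∞ p(m)·((n-1)/n)^m and q₀₀ = Σ_{m=0}^∞ p(m)·((n-2)/n)^m, and assume q₀ > 0. Then the deviation from independence δ₀ = q₀₀/q₀ - q₀ satisfies |δ₀| ≤ min{1, μ/n}. -/

import Mathlib

theorem pow_sub_pow_le_nat_mul_sub {a b : ℝ} (ha : 0 ≤ a) (hab : a ≤ b) (hb : b ≤ 1) (m : ℕ) :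
    b ^ m - a ^ m ≤ m * (b - a) := by
  induction m with
  | zero => simp
  | succ k ih =>
    have hak : a ^ k ≤ 1 := pow_le_one₀ ha (hab.trans hb)
    calc b ^ (k + 1) - a ^ (k + 1) = b * (b ^ k - a ^ k) + a ^ k * (b - a) := by ring
      _ ≤ 1 * (b ^ k - a ^ k) + 1 * (b - a) := by
        have : a ^ k ≤ b ^ k := pow_le_pow_left₀ ha hab k
        gcongr
      _ ≤ ((k + 1 : ℕ) : ℝ) * (b - a) := by push_cast; linarith

theorem summable_mul_pow_of_le_one {p : ℕ → ℝ} (hp : ∀ m, 0 ≤ p m) (hs : Summable p)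
    {x : ℝ} (hx0 : 0 ≤ x) (hx1 : x ≤ 1) : Summable fun m => p m * x ^ m :=
  hs.of_nonneg_of_le (fun m => mul_nonneg (hp m) (pow_nonneg hx0 m))
    fun m => mul_le_of_le_one_right (hp m) (pow_le_one₀ hx0 hx1)

/-- Chebyshev's correlation inequality for the decreasing sequences `x ^ m` and `r ^ m`. -/
theorem tsum_mul_pow_mul_tsum_mul_pow_le {p : ℕ → ℝ} (hp : ∀ m, 0 ≤ p m)
    (hsum : ∑' m, p m = 1) (hs : Summable p) {x r : ℝ} (hx0 : 0 ≤ x) (hx1 : x ≤ 1)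
    (hr0 : 0 ≤ r) (hr1 : r < 1) :
    (∑' m, p m * x ^ m) * (∑' m, p m * r ^ m) ≤ ∑' m, p m * (x * r) ^ m := by
  have hsx := summable_mul_pow_of_le_one hp hs hx0 hx1
  have hsr := summable_mul_pow_of_le_one hp hs hr0 hr1.le
  have hsxr := summable_mul_pow_of_le_one hp hs (mul_nonneg hx0 hr0)
    (mul_le_one₀ hx1 hr0 hr1.le)
  set R := ∑' m, p m * r ^ m with hR
  have hR0 : 0 ≤ R := tsum_nonneg fun m => mul_nonneg (hp m) (pow_nonneg hr0 m)
  rcases hR0.eq_or_lt with h0 | hRpos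
  · rw [← h0, mul_zero]
    exact tsum_nonneg fun m => mul_nonneg (hp m) (pow_nonneg (mul_nonneg hx0 hr0) m)
  have hex : ∃ k, r ^ k < R := exists_pow_lt_of_lt_one hRpos hr1
  classical
  obtain ⟨k, hk, hmin⟩ : ∃ k, r ^ k < R ∧ ∀ m < k, R ≤ r ^ m :=
    ⟨Nat.find hex, Nat.find_spec hex, fun m hm => not_lt.1 (Nat.find_min hex hm)⟩
  have hpt : ∀ m, 0 ≤ p m * ((x ^ m - x ^ k) * (r ^ m - R)) := by
    intro m
    refine mul_nonneg (hp m) ?_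
    rcases lt_or_ge m k with h | h
    · exact mul_nonneg (sub_nonneg.2 (pow_le_pow_of_le_one hx0 hx1 h.le))
        (sub_nonneg.2 (hmin m h))
    · exact mul_nonneg_of_nonpos_of_nonpos
        (sub_nonpos.2 (pow_le_pow_of_le_one hx0 hx1 h))
        (sub_nonpos.2 ((pow_le_pow_of_le_one hr0 hr1.le h).trans hk.le))
  have hsumAll := ((hsxr.hasSum.sub (hsx.hasSum.mul_left R)).sub
    (hsr.hasSum.mul_left (x ^ k))).add (hs.hasSum.mul_left (x ^ k * R))
  have h := hsumAll.nonneg fun m => by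
    have := hpt m
    rw [mul_pow]
    linarith
  rw [hsum, ← hR] at h
  linarith

/-- δ₀ part of the Asymptotic Independence Theorem: with `p` a pmf on `ℕ` with
finite mean `μ`, `n ≥ 2`, `q₀ = Σ p(m)((n-1)/n)^m`, `q₀₀ = Σ p(m)((n-2)/n)^m`,
and `q₀ > 0`, the deviation `δ₀ = q₀₀/q₀ - q₀` satisfies `|δ₀| ≤ min {1, μ/n}`. -/
theorem delta_zero_bound (p : ℕ → ℝ) (hp : ∀ m : ℕ, 0 ≤ p m)
    (hsum : ∑' m : ℕ, p m = 1) (hmean : Summable fun m : ℕ => (m : ℝ) * p m)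
    (μ : ℝ) (hμ : μ = ∑' m : ℕ, (m : ℝ) * p m) (n : ℕ) (hn : 2 ≤ n)
    (q₀ q₀₀ : ℝ) (hq₀ : q₀ = ∑' m : ℕ, p m * (((n : ℝ) - 1) / n) ^ m)
    (hq₀₀ : q₀₀ = ∑' m : ℕ, p m * (((n : ℝ) - 2) / n) ^ m)
    (hq₀pos : 0 < q₀) (δ₀ : ℝ) (hδ₀ : δ₀ = q₀₀ / q₀ - q₀) :
    |δ₀| ≤ min 1 (μ / n) := by
  have hs : Summable p := by
    by_contra h
    rw [tsum_eq_zero_of_not_summable h] at hsum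
    exact zero_ne_one hsum
  have hn' : (2 : ℝ) ≤ n := by exact_mod_cast hn
  have hn0 : (0 : ℝ) < n := by linarith
  have hn1 : (0 : ℝ) < n - 1 := by linarith
  set x : ℝ := ((n : ℝ) - 1) / n with hx
  set y : ℝ := ((n : ℝ) - 2) / n with hy
  set r : ℝ := ((n : ℝ) - 2) / (n - 1) with hr
  have hx0 : 0 ≤ x := by positivity
  have hy0 : 0 ≤ y := div_nonneg (by linarith) hn0.le
  have hr0 : 0 ≤ r := div_nonneg (by linarith) hn1.le
  have hx1 : x ≤ 1 := (div_le_one hn0).2 (by linarith)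
  have hyx : y ≤ x := div_le_div_of_nonneg_right (by linarith) hn0.le
  have hr1 : r < 1 := (div_lt_one hn1).2 (by linarith)
  have hxr : x * r = y := by rw [hx, hr, hy]; field_simp
  have hxsub : 1 - x = 1 / n := by rw [hx]; field_simp; ring
  have hdiff : x - r = 1 / (n * (n - 1)) := by rw [hx, hr]; field_simp; ring
  have hrx : r ≤ x := sub_nonneg.1 (by rw [hdiff]; positivity)
  have hdiff_le : x - r ≤ 1 / n := by
    rw [hdiff]
    exact one_div_le_one_div_of_le hn0 (le_mul_of_one_le_right hn0.le (by linarith))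
  have hsx := summable_mul_pow_of_le_one hp hs hx0 hx1
  have hsy := summable_mul_pow_of_le_one hp hs hy0 (hyx.trans hx1)
  have hsr := summable_mul_pow_of_le_one hp hs hr0 hr1.le
  have hmeanSum : HasSum (fun m : ℕ => (m : ℝ) * p m * (1 / n)) (μ / n) := by
    rw [hμ, div_eq_mul_one_div (tsum _)]
    exact hmean.hasSum.mul_right _
  have hq₀₀_nonneg : 0 ≤ q₀₀ := by
    rw [hq₀₀]
    exact tsum_nonneg fun m => mul_nonneg (hp m) (pow_nonneg hy0 m)
  have hq₀₀_le : q₀₀ ≤ q₀ := by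
    rw [hq₀₀, hq₀]
    exact hsy.tsum_le_tsum (fun m => mul_le_mul_of_nonneg_left
      (pow_le_pow_left₀ hy0 hyx m) (hp m)) hsx
  have hq₀_le : q₀ ≤ 1 := by
    rw [hq₀, ← hsum]
    exact hsx.tsum_le_tsum (fun m => mul_le_of_le_one_right (hp m) (pow_le_one₀ hx0 hx1)) hs
  have hupper : 1 - q₀ ≤ μ / n := by
    rw [hq₀, ← hsum]
    refine hasSum_le (fun m => ?_) (hs.hasSum.sub hsx.hasSum) hmeanSum
    have h := mul_le_mul_of_nonneg_left (pow_sub_pow_le_nat_mul_sub hx0 hx1 le_rfl m) (hp m)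
    rw [one_pow, hxsub] at h
    linarith
  have hlower : q₀ - ∑' m, p m * r ^ m ≤ μ / n := by
    rw [hq₀]
    refine hasSum_le (fun m => ?_) (hsx.hasSum.sub hsr.hasSum) hmeanSum
    have h := mul_le_mul_of_nonneg_left ((pow_sub_pow_le_nat_mul_sub hr0 hrx hx1 m).trans
      (mul_le_mul_of_nonneg_left hdiff_le m.cast_nonneg)) (hp m)
    linarith
  have hcheb : ∑' m, p m * r ^ m ≤ q₀₀ / q₀ := by
    rw [le_div_iff₀ hq₀pos, mul_comm, hq₀, hq₀₀, ← hxr]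
    exact tsum_mul_pow_mul_tsum_mul_pow_le hp hsum hs hx0 hx1 hr0 hr1
  have hdiv_nonneg : 0 ≤ q₀₀ / q₀ := div_nonneg hq₀₀_nonneg hq₀pos.le
  have hdiv_le : q₀₀ / q₀ ≤ 1 := (div_le_one hq₀pos).2 hq₀₀_le
  rw [hδ₀]
  exact le_min (abs_le.2 ⟨by linarith, by linarith⟩) (abs_le.2 ⟨by linarith, by linarith⟩)
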